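/- arXiv:1003.0083 — 4 statements merged into one kernel-verified Lean document; each statement's English description precedes it below -/
import Mathlib

section
/- For every integer q ≥ 3, the function Φ(β) := ((q−2)²/(q−1)) · Σ_{k=1}^{∞} Σ_{n=1}^{k} (q−1)^{−k} · exp(−4β√(q−1)·sin²(nπ/(2(k+1)))), defined for β > 0, is the Laplace transform of a Borel probability measure on the real line whose support is contained in the interval [0, 4√(q−1)]; that is, there exists a Borel probability measure F on ℝ with F([0, 4√(q−1)]) = 1 such that Φ(β) = ∫ e^{−βx} dF(x) for all β > 0. -/
open Filter MeasureTheory Set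
open scoped Topology Classical ENNReal

noncomputable section

/-- The Hilbert space ℓ²(V) with complex coefficients. -/
abbrev L2 (V : Type) := lp (fun _ : V => ℂ) 2

/-- The coordinate (delta) vector at a vertex `x`. -/
def delta {V : Type} (x : V) : L2 V :=
  haveI := Classical.decEq V; lp.single 2 x 1

/-- The matrix entry `B_{x y} = (B δ_y)(x)` of a bounded operator on ℓ²(V). -/
def entry {V : Type} (B : L2 V →L[ℂ] L2 V) (x y : V) : ℂ :=
  (B (delta y) : ∀ _ : V, ℂ) x

/-- The resolvent `R_B(z) = (z·1 − B)⁻¹` (junk value if not invertible). -/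
def Res {V : Type} (B : L2 V →L[ℂ] L2 V) (z : ℂ) : L2 V →L[ℂ] L2 V :=
  Ring.inverse (z • (1 : L2 V →L[ℂ] L2 V) - B)

/-- The resolvent at a real point. -/
def ResR {V : Type} (B : L2 V →L[ℂ] L2 V) (l : ℝ) : L2 V →L[ℂ] L2 V :=
  Res B (l : ℂ)

/-- `G` is the homogeneous Cayley tree of degree `Q`: connected, acyclic,
and every vertex has exactly `Q` neighbours. -/
structure IsCayleyTree {V : Type} (G : SimpleGraph V) (Q : ℕ) : Prop where
  conn : G.Connected
  acyc : G.IsAcyclic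
  deg : ∀ v : V, (G.neighborSet v).ncard = Q

/-- `A` is the adjacency operator of the simple graph `G` on ℓ²(V). -/
def IsAdjacencyOp {V : Type} (G : SimpleGraph V) (A : L2 V →L[ℂ] L2 V) : Prop :=
  ∀ x y : V, entry A x y = if G.Adj x y then 1 else 0

/-- `P` assigns to each subset `S ⊆ V` the orthogonal projection of ℓ²(V) onto ℓ²(S). -/
def IsProjFamily {V : Type} (P : Set V → (L2 V →L[ℂ] L2 V)) : Prop :=
  ∀ (S : Set V) (f : L2 V) (x : V),
    (P S f : ∀ _ : V, ℂ) x = if x ∈ S then (f : ∀ _ : V, ℂ) x else 0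

/-- `S` is the vertex set of a connected subtree of `G` in which every vertex has
exactly `q` neighbours within `S` (a subtree of constant internal degree `q`). -/
def IsRegularSubtree {V : Type} (G : SimpleGraph V) (S : Set V) (q : ℕ) : Prop :=
  (G.induce S).Connected ∧ ∀ x ∈ S, {y : V | y ∈ S ∧ G.Adj x y}.ncard = q

/-- Distance from a vertex to a set of vertices. -/
def distToSet {V : Type} (G : SimpleGraph V) (x : V) (S : Set V) : ℕ :=
  sInf {n : ℕ | ∃ y ∈ S, G.dist x y = n}

/-- `a(λ)` of equation (4.2) of the paper, for the tree of degree `Q`. -/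
def aF (Q : ℕ) (l : ℝ) : ℝ :=
  l * (1 - Real.sqrt (1 - 4 * ((Q : ℝ) - 1) / l ^ 2)) / (2 * ((Q : ℝ) - 1))

/-- `μ(λ)` of equation (4.3) of the paper, for the tree of degree `Q`. -/
def muF (Q : ℕ) (l : ℝ) : ℝ :=
  l * (((Q : ℝ) - 2) + (Q : ℝ) * Real.sqrt (1 - 4 * ((Q : ℝ) - 1) / l ^ 2)) /
    (2 * ((Q : ℝ) - 1))

/-- `M` realizes the inverse, within the corner algebra `P·B(ℓ²)·P`, of the operator
`P − P T P` (that is, of `I_{ℓ²(S)} − S(λ)` when `T` is the resolvent and `P = P_{ℓ²(S)}`). -/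
def IsCornerInverse {V : Type} (P M T : L2 V →L[ℂ] L2 V) : Prop :=
  P ∘L M = M ∧ M ∘L P = M ∧
    M ∘L (P - P ∘L T ∘L P) = P ∧ (P - P ∘L T ∘L P) ∘L M = P

/-- The limiting one-particle partition function `Φ(β)` of equation (2.3) of the paper,
for the Cayley tree of degree `q` (the sum over `k ≥ 1` is re-indexed by `k ↦ k+1`). -/
def Phi (q : ℕ) (β : ℝ) : ℝ :=
  (((q : ℝ) - 2) ^ 2 / ((q : ℝ) - 1)) *
    ∑' k : ℕ, ∑ n ∈ Finset.Icc 1 (k + 1),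
      ((q : ℝ) - 1) ^ (-((k : ℤ) + 1)) *
        Real.exp (-(4 * β * Real.sqrt ((q : ℝ) - 1) *
          Real.sin ((n : ℝ) * Real.pi / (2 * ((k : ℝ) + 2))) ^ 2))

/-- The total mass of the weights `r ^ (k + 1)`, each taken `k + 1` times. -/
lemma hasSum_succ_mul_geometric {r : ℝ} (h0 : 0 ≤ r) (h1 : r < 1) :
    HasSum (fun k : ℕ => ((k : ℝ) + 1) * r ^ (k + 1)) (r / (1 - r) ^ 2) := by
  have h := hasSum_coe_mul_geometric_of_norm_lt_one
    (show ‖r‖ < 1 by rwa [Real.norm_of_nonneg h0])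
  simpa using (hasSum_nat_add_iff' 1).2 h

/-- The measure with an atom of mass `w k` at `x k n` for every `k` and `1 ≤ n ≤ k + 1`. -/
def triangularMeasure (w : ℕ → ℝ) (x : ℕ → ℕ → ℝ) : Measure ℝ :=
  Measure.sum fun k => ∑ n ∈ Finset.Icc 1 (k + 1), ENNReal.ofReal (w k) • Measure.dirac (x k n)

lemma isProbabilityMeasure_triangularMeasure {w : ℕ → ℝ} (x : ℕ → ℕ → ℝ) (hw : ∀ k, 0 ≤ w k)
    (hsum : HasSum (fun k : ℕ => ((k : ℝ) + 1) * w k) 1) :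
    IsProbabilityMeasure (triangularMeasure w x) := by
  have hnn (k : ℕ) : 0 ≤ ((k : ℝ) + 1) * w k := mul_nonneg (by positivity) (hw k)
  refine ⟨?_⟩
  have hterm (k : ℕ) : (∑ n ∈ Finset.Icc 1 (k + 1),
      ENNReal.ofReal (w k) • Measure.dirac (x k n)) univ
        = ENNReal.ofReal (((k : ℝ) + 1) * w k) := by
    rw [ENNReal.ofReal_mul (by positivity), ENNReal.ofReal_add (by positivity) zero_le_one]
    simp
  rw [triangularMeasure, Measure.sum_apply _ MeasurableSet.univ]
  simp_rw [hterm]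
  rw [← ENNReal.ofReal_tsum_of_nonneg hnn hsum.summable, hsum.tsum_eq, ENNReal.ofReal_one]

lemma triangularMeasure_compl_eq_zero (w : ℕ → ℝ) {x : ℕ → ℕ → ℝ} {s : Set ℝ}
    (hs : MeasurableSet s) (hx : ∀ k n, x k n ∈ s) : triangularMeasure w x sᶜ = 0 := by
  rw [triangularMeasure, Measure.sum_apply _ hs.compl]
  simp [Measure.dirac_apply' _ hs.compl, hx]

lemma integral_triangularMeasure {w : ℕ → ℝ} {x : ℕ → ℕ → ℝ} (hw : ∀ k, 0 ≤ w k) {f : ℝ → ℝ}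
    (hf : Integrable f (triangularMeasure w x)) :
    ∫ y, f y ∂triangularMeasure w x = ∑' k, ∑ n ∈ Finset.Icc 1 (k + 1), w k * f (x k n) := by
  rw [triangularMeasure, integral_sum_measure hf]
  refine tsum_congr fun k => ?_
  rw [integral_finsetSum_measure fun n _ =>
    (integrable_dirac (by simp)).smul_measure ENNReal.ofReal_ne_top]
  simp [hw k]

/-- **Proposition 2.1.** `Φ(β)` is the Laplace transform of (the cumulative function of) a
probability measure on the real line supported in `[0, 4√(q−1)]`. -/
theorem phi_is_laplace_transform_of_probability_measure (q : ℕ) (hq : 3 ≤ q) :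
    ∃ F : Measure ℝ, IsProbabilityMeasure F ∧
      F (Set.Icc (0 : ℝ) (4 * Real.sqrt ((q : ℝ) - 1)))ᶜ = 0 ∧
      ∀ β : ℝ, 0 < β → Phi q β = ∫ x, Real.exp (-β * x) ∂F := by
  have hq3 : (3 : ℝ) ≤ q := by exact_mod_cast hq
  have hp : (0 : ℝ) < (q : ℝ) - 1 := by linarith
  have hq2 : (q : ℝ) - 2 ≠ 0 := by linarith
  set c : ℝ := ((q : ℝ) - 2) ^ 2 / ((q : ℝ) - 1) with hc
  set r : ℝ := ((q : ℝ) - 1)⁻¹ with hr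
  have hr0 : 0 ≤ r := by positivity
  have hr1 : r < 1 := inv_lt_one_of_one_lt₀ (by linarith)
  let w : ℕ → ℝ := fun k => c * r ^ (k + 1)
  let x : ℕ → ℕ → ℝ := fun k n => 4 * Real.sqrt ((q : ℝ) - 1) *
    Real.sin ((n : ℝ) * Real.pi / (2 * ((k : ℝ) + 2))) ^ 2
  have hw (k : ℕ) : 0 ≤ w k := by positivity
  have hx (k n : ℕ) : x k n ∈ Set.Icc (0 : ℝ) (4 * Real.sqrt ((q : ℝ) - 1)) :=
    ⟨by positivity, mul_le_of_le_one_right (by positivity) (Real.sin_sq_le_one _)⟩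
  have hsum : HasSum (fun k : ℕ => ((k : ℝ) + 1) * w k) 1 := by
    have hone : c * (r / (1 - r) ^ 2) = 1 := by
      have hsub : 1 - r = ((q : ℝ) - 2) * r := by
        rw [hr]
        field_simp
        ring
      rw [hsub, hc, hr]
      field_simp
    have h := (hasSum_succ_mul_geometric hr0 hr1).mul_left c
    rw [hone] at h
    simp_rw [mul_left_comm c] at h
    exact h
  have hprob := isProbabilityMeasure_triangularMeasure x hw hsum
  have hsupp := triangularMeasure_compl_eq_zero w measurableSet_Icc hx
  refine ⟨triangularMeasure w x, hprob, hsupp, fun β hβ => ?_⟩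
  have hint : Integrable (fun y => Real.exp (-β * y)) (triangularMeasure w x) := by
    refine Integrable.of_bound (by fun_prop) 1 ?_
    have hae : ∀ᵐ y ∂triangularMeasure w x,
        y ∈ Set.Icc (0 : ℝ) (4 * Real.sqrt ((q : ℝ) - 1)) := mem_ae_iff.2 hsupp
    filter_upwards [hae] with y hy
    rw [Real.norm_of_nonneg (Real.exp_nonneg _), Real.exp_le_one_iff, neg_mul]
    exact neg_nonpos.2 (mul_nonneg hβ.le hy.1)
  rw [integral_triangularMeasure hw hint, Phi, ← hc, ← tsum_mul_left]
  refine tsum_congr fun k => ?_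
  rw [Finset.mul_sum]
  refine Finset.sum_congr rfl fun n _ => ?_
  have hpow : ((q : ℝ) - 1) ^ (-((k : ℤ) + 1)) = r ^ (k + 1) := by
    rw [zpow_neg, hr, inv_pow]
    norm_cast
  rw [hpow, ← mul_assoc]
  congr 2
  simp only [x]
  ring
end
end

section
/- Let Q ≥ 3 be an integer, A = A_{𝔾^Q} the adjacency operator of the homogeneous Cayley tree of degree Q, S a subset of the vertex set, and A_Y := A + P_{ℓ²(S)} the adjacency operator of the graph Y obtained by adding one self-loop at each vertex of S. Then, for λ ranging over (2√(Q−1), ∞), the secular equation ‖P_{ℓ²(S)} R_A(λ) P_{ℓ²(S)}‖ = 1 has at most one solution; if a solution exists, it equals ‖A_Y‖. Conversely, if λ* := ‖A_Y‖ > 2√(Q−1), then λ* satisfies ‖P_{ℓ²(S)} R_A(λ*) P_{ℓ²(S)}‖ = 1. -/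
open Filter MeasureTheory Set
open scoped Topology Classical ENNReal

noncomputable section

section CStarAlgebra

variable {𝒜 : Type*} [CStarAlgebra 𝒜] [PartialOrder 𝒜] [StarOrderedRing 𝒜]

/-- A scalar above the norm of a self-adjoint element gives a strictly positive shift. -/
lemma IsSelfAdjoint.isStrictlyPositive_algebraMap_sub {a : 𝒜} (ha : IsSelfAdjoint a) {l : ℝ}
    (hl : ‖a‖ < l) : IsStrictlyPositive (algebraMap ℝ 𝒜 l - a) := by
  have h : IsStrictlyPositive (algebraMap ℝ 𝒜 (l - ‖a‖)) :=
    isStrictlyPositive_algebraMap (sub_pos.2 hl)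
  refine h.of_le ?_
  rw [map_sub]
  exact sub_le_sub_left ha.le_algebraMap_norm_self _

lemma norm_eq_one_iff_of_nonneg [Nontrivial 𝒜] {k : 𝒜} (hk : 0 ≤ k) :
    ‖k‖ = 1 ↔ 0 ≤ 1 - k ∧ ¬ IsUnit (1 - k) := by
  rw [sub_nonneg, ← CStarAlgebra.norm_le_one_iff_of_nonneg k hk]
  have hspec : (1 : ℝ) ∈ spectrum ℝ k ↔ ¬ IsUnit (1 - k) := by
    rw [spectrum.mem_iff, map_one]
  rw [← hspec]
  constructor
  · intro h
    exact ⟨h.le, h ▸ CStarAlgebra.norm_mem_spectrum_of_nonneg hk⟩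
  · rintro ⟨h, h'⟩
    refine le_antisymm h ?_
    simpa using spectrum.norm_le_norm_of_mem h'

/-- If a self-adjoint `x` satisfies `x > -l`, then `l = ‖x‖` means that `l` is the top of the
spectrum of `x`. -/
lemma IsSelfAdjoint.eq_norm_iff [Nontrivial 𝒜] {x : 𝒜} (hx : IsSelfAdjoint x) {l : ℝ} (hl : 0 ≤ l)
    (hpos : IsStrictlyPositive (algebraMap ℝ 𝒜 l + x)) :
    l = ‖x‖ ↔ 0 ≤ algebraMap ℝ 𝒜 l - x ∧ ¬ IsUnit (algebraMap ℝ 𝒜 l - x) := by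
  rw [sub_nonneg, ← spectrum.mem_iff]
  constructor
  · intro h
    refine ⟨h ▸ hx.le_algebraMap_norm_self, ?_⟩
    rcases CStarAlgebra.norm_or_neg_norm_mem_spectrum hx with h' | h'
    · rwa [h]
    · rw [← h, spectrum.mem_iff, map_neg, ← neg_add', IsUnit.neg_iff] at h'
      exact absurd hpos.isUnit h'
  · rintro ⟨h, h'⟩
    refine le_antisymm ?_ ?_
    · simpa [abs_of_nonneg hl] using spectrum.norm_le_norm_of_mem h'
    · rcases CStarAlgebra.norm_or_neg_norm_mem_spectrum hx with hs | hs
      · exact (le_algebraMap_iff_spectrum_le hx).1 h _ hs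
      · have h0 : algebraMap ℝ 𝒜 (-l) ≤ x := by
          rw [map_neg]
          exact neg_le_iff_add_nonneg'.2 hpos.nonneg
        exact neg_le_neg_iff.1 ((algebraMap_le_iff_le_spectrum hx).1 h0 _ hs)

/-- The Birman–Schwinger principle for the perturbation of a self-adjoint element by a
projection, at a point above the norm of the unperturbed element. -/
lemma IsSelfAdjoint.norm_compress_inverse_eq_one_iff [Nontrivial 𝒜] {a p : 𝒜}
    (ha : IsSelfAdjoint a) (hp : IsSelfAdjoint p) (hpp : p * p = p) {l : ℝ} (hl : ‖a‖ < l) :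
    ‖p * Ring.inverse (algebraMap ℝ 𝒜 l - a) * p‖ = 1 ↔ l = ‖a + p‖ := by
  have hp0 : 0 ≤ p := by
    have := star_mul_self_nonneg p
    rwa [hp.star_eq, hpp] at this
  have hb := ha.isStrictlyPositive_algebraMap_sub hl
  set b := algebraMap ℝ 𝒜 l - a with hbdef
  have hs0 : 0 ≤ b ^ (1 / 2 : ℝ) := CFC.rpow_nonneg
  have ht0 : 0 ≤ b ^ (-(1 / 2) : ℝ) := CFC.rpow_nonneg
  have hst : b ^ (1 / 2 : ℝ) * b ^ (-(1 / 2) : ℝ) = 1 := CFC.rpow_mul_rpow_neg _ hb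
  have hts : b ^ (-(1 / 2) : ℝ) * b ^ (1 / 2 : ℝ) = 1 := CFC.rpow_neg_mul_rpow _ hb
  have hss : b ^ (1 / 2 : ℝ) * b ^ (1 / 2 : ℝ) = b := by
    rw [← CFC.rpow_add hb.isUnit, add_halves, CFC.rpow_one b hb.nonneg]
  have htt : b ^ (-(1 / 2) : ℝ) * b ^ (-(1 / 2) : ℝ) = Ring.inverse b := by
    rw [← CFC.rpow_add hb.isUnit, ← neg_add, add_halves, CFC.inverse_eq_rpow_neg_one hb]
  generalize b ^ (1 / 2 : ℝ) = s at *
  generalize b ^ (-(1 / 2) : ℝ) = t at *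
  have hsa : IsSelfAdjoint s := .of_nonneg hs0
  have hta : IsSelfAdjoint t := .of_nonneg ht0
  have hnorm : ‖p * Ring.inverse b * p‖ = ‖t * p * t‖ := by
    have h1 : p * Ring.inverse b * p = star (t * p) * (t * p) := by
      rw [star_mul, hp.star_eq, hta.star_eq, ← htt]; simp only [mul_assoc]
    have h2 : t * p * t = t * p * star (t * p) := by
      rw [star_mul, hp.star_eq, hta.star_eq, mul_assoc t p (p * t), ← mul_assoc p p t, hpp,
        mul_assoc]
    rw [h1, h2, CStarRing.norm_star_mul_self, CStarRing.norm_self_mul_star]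
  have hk0 : 0 ≤ t * p * t := conjugate_nonneg_of_nonneg hp0 ht0
  have hconj : s * (1 - t * p * t) * s = algebraMap ℝ 𝒜 l - (a + p) := by
    have : s * (1 - t * p * t) * s = s * s - (s * t) * p * (t * s) := by noncomm_ring
    rw [this, hss, hst, hts, hbdef]; noncomm_ring
  have hconj' : t * (algebraMap ℝ 𝒜 l - (a + p)) * t = 1 - t * p * t := by
    rw [← hconj]
    have : t * (s * (1 - t * p * t) * s) * t = (t * s) * (1 - t * p * t) * (s * t) := by
      simp only [mul_assoc]
    rw [this, hts, hst, one_mul, mul_one]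
  have hsu : IsUnit s := ⟨⟨s, t, hst, hts⟩, rfl⟩
  have hl0 : 0 ≤ l := (norm_nonneg a).trans hl.le
  have hpos : IsStrictlyPositive (algebraMap ℝ 𝒜 l + (a + p)) := by
    have h := ha.neg.isStrictlyPositive_algebraMap_sub (l := l) (by rwa [norm_neg])
    rw [sub_neg_eq_add] at h
    exact h.of_le (by rw [← add_assoc]; exact le_add_of_nonneg_right hp0)
  rw [hnorm, norm_eq_one_iff_of_nonneg hk0, (ha.add hp).eq_norm_iff hl0 hpos]
  refine and_congr ⟨fun h => ?_, fun h => ?_⟩ (not_congr ?_)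
  · rw [← hconj]; exact conjugate_nonneg_of_nonneg h hs0
  · rw [← hconj']; exact conjugate_nonneg_of_nonneg h ht0
  · rw [← hconj, hsu.mul_right_iff, hsu.mul_left_iff]

end CStarAlgebra

section Tree

variable {V : Type} {G : SimpleGraph V}

/-- In a tree rooted at `o`, all neighbours of `x` but the penultimate vertex of the path from `o`
to `x` are farther from `o` than `x`. -/
lemma SimpleGraph.IsAcyclic.exists_forall_adj_dist_eq (hG : G.IsAcyclic) (hc : G.Connected)
    (o x : V) : ∃ y₀, ∀ y, G.Adj x y → y ≠ y₀ → G.dist o y = G.dist o x + 1 := by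
  obtain ⟨p, hp, -⟩ := hc.exists_path_of_dist o x
  refine ⟨p.penultimate, fun y hxy hy => ?_⟩
  rcases hG.dist_eq_dist_add_one_of_adj_of_reachable o hxy (hc o x) with h | h
  · obtain ⟨q, hq, hql⟩ := hc.exists_path_of_dist o y
    refine absurd (hG.eq_penultimate_of_adj_end hp hxy ?_) hy
    by_contra hyp
    have hx := hG.mem_support_of_ne_mem_support_of_adj_of_isPath hq hp hxy.symm hyp
    have h1 := G.dist_le (q.takeUntil x hx)
    have h2 := q.length_takeUntil_le_length hx
    omega
  · exact h

/-- The radial function `s ^ (-|x|)`, `s = √(Q - 1)`, is `2s`-superharmonic for the adjacency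
operator of the tree of degree `Q`. -/
lemma IsCayleyTree.sum_adj_weight_le {Q : ℕ} (hG : IsCayleyTree G Q) {s : ℝ} (hs : 1 ≤ s)
    (hsQ : s * s = Q - 1) (o x : V) (N : Finset V) (hN : ∀ y, y ∈ N ↔ G.Adj x y)
    (hcard : N.card = Q) :
    ∑ y ∈ N, s⁻¹ ^ G.dist o y ≤ 2 * s * s⁻¹ ^ G.dist o x := by
  have hs0 : 0 < s := zero_lt_one.trans_le hs
  obtain ⟨y₀, hy₀⟩ := hG.acyc.exists_forall_adj_dist_eq hG.conn o x
  set w := s⁻¹ ^ G.dist o x with hw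
  have hw0 : 0 < w := by positivity
  have hgap : 0 ≤ (s - s⁻¹) * w :=
    mul_nonneg (sub_nonneg.2 ((inv_le_one_of_one_le₀ hs).trans hs)) hw0.le
  have hterm : ∀ y ∈ N, s⁻¹ ^ G.dist o y ≤ s⁻¹ * w + if y = y₀ then (s - s⁻¹) * w else 0 := by
    intro y hy
    have hadj := (hN y).1 hy
    rcases hG.acyc.dist_eq_dist_add_one_of_adj_of_reachable o hadj (hG.conn o x) with h | h
    · have hyy : y = y₀ := by
        by_contra hne
        have := hy₀ y hadj hne
        omega
      rw [if_pos hyy, hw, h, pow_succ]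
      apply le_of_eq
      field_simp
      ring
    · rw [h, pow_succ, ← hw, mul_comm w]
      split_ifs
      · linarith
      · linarith
  calc ∑ y ∈ N, s⁻¹ ^ G.dist o y
      ≤ ∑ y ∈ N, (s⁻¹ * w + if y = y₀ then (s - s⁻¹) * w else 0) := Finset.sum_le_sum hterm
    _ = Q * (s⁻¹ * w) + if y₀ ∈ N then (s - s⁻¹) * w else 0 := by
        rw [Finset.sum_add_distrib, Finset.sum_const, hcard, nsmul_eq_mul, Finset.sum_ite_eq']
    _ ≤ Q * (s⁻¹ * w) + (s - s⁻¹) * w := by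
        gcongr
        split_ifs
        · exact le_rfl
        · exact hgap
    _ = 2 * s * w := by
        have : (Q : ℝ) = s * s + 1 := by linarith
        rw [this]
        field_simp
        ring

end Tree

section SchurTest

variable {V : Type} {G : SimpleGraph V} {A : L2 V →L[ℂ] L2 V}

lemma IsAdjacencyOp.apply_eq_sum (hA : IsAdjacencyOp G A) (hsa : IsSelfAdjoint A) (x : V)
    (N : Finset V) (hN : ∀ y, y ∈ N ↔ G.Adj x y) (f : L2 V) :
    (A f : ∀ _ : V, ℂ) x = ∑ y ∈ N, (f : ∀ _ : V, ℂ) y := by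
  have h1 : inner ℂ (A (delta x)) f = (A f : ∀ _ : V, ℂ) x := by
    rw [← ContinuousLinearMap.adjoint_inner_right, ← ContinuousLinearMap.star_eq_adjoint,
      hsa.star_eq, delta, lp.inner_single_left]
    simp
  rw [← h1, lp.inner_eq_tsum, tsum_eq_sum (s := N)]
  · refine Finset.sum_congr rfl fun y hy => ?_
    have h : (A (delta x) : ∀ _ : V, ℂ) y = 1 := by
      have := hA y x
      rwa [if_pos ((hN y).1 hy).symm] at this
    simp [h]
  · intro y hy
    have h : (A (delta x) : ∀ _ : V, ℂ) y = 0 := by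
      have := hA y x
      rwa [if_neg (fun h => hy ((hN y).2 h.symm))] at this
    simp [h]

/-- The Schur test for a self-adjoint adjacency operator, with a positive weight `w`. -/
lemma IsAdjacencyOp.norm_le_of_weight (hA : IsAdjacencyOp G A) (hsa : IsSelfAdjoint A)
    (N : V → Finset V) (hN : ∀ x y, y ∈ N x ↔ G.Adj x y) (w : V → ℝ) (hw : ∀ x, 0 < w x)
    {c : ℝ} (hc : 0 ≤ c) (hsum : ∀ x, ∑ y ∈ N x, w y ≤ c * w x) : ‖A‖ ≤ c := by
  refine A.opNorm_le_bound hc fun f => ?_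
  have hpow : ∀ t : ℝ, t ^ (2 : ℝ≥0∞).toReal = t ^ 2 := fun t => by simp
  refine lp.norm_le_of_forall_sum_le (by simp) (by positivity) fun s => ?_
  simp only [hpow]
  have hpt : ∀ x, ‖(A f : ∀ _ : V, ℂ) x‖ ^ 2 ≤ ∑ y ∈ N x, c * w x * (‖f y‖ ^ 2 / w y) := by
    intro x
    rw [hA.apply_eq_sum hsa x (N x) (hN x)]
    have h1 : (∑ y ∈ N x, ‖f y‖) ^ 2 ≤ (∑ y ∈ N x, w y) * ∑ y ∈ N x, ‖f y‖ ^ 2 / w y := by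
      refine Finset.sum_sq_le_sum_mul_sum_of_sq_le_mul _ (fun y _ => (hw y).le)
        (fun y _ => div_nonneg (sq_nonneg _) (hw y).le) fun y _ => ?_
      have := (hw y).ne'
      rw [mul_div_cancel₀ _ this]
    have h0 : 0 ≤ ∑ y ∈ N x, ‖f y‖ ^ 2 / w y :=
      Finset.sum_nonneg fun y _ => div_nonneg (sq_nonneg _) (hw y).le
    calc ‖∑ y ∈ N x, f y‖ ^ 2 ≤ (∑ y ∈ N x, ‖f y‖) ^ 2 := by
          gcongr; exact norm_sum_le _ _
      _ ≤ _ := h1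
      _ ≤ c * w x * ∑ y ∈ N x, ‖f y‖ ^ 2 / w y := by gcongr; exact hsum x
      _ = _ := Finset.mul_sum _ _ _
  have hnn : ∀ x y, 0 ≤ c * w x * (‖f y‖ ^ 2 / w y) := fun x y =>
    mul_nonneg (mul_nonneg hc (hw x).le) (div_nonneg (sq_nonneg _) (hw y).le)
  calc ∑ x ∈ s, ‖(A f : ∀ _ : V, ℂ) x‖ ^ 2
      ≤ ∑ x ∈ s, ∑ y ∈ N x, c * w x * (‖f y‖ ^ 2 / w y) := Finset.sum_le_sum fun x _ => hpt x
    _ = ∑ y ∈ s.biUnion N, ∑ x ∈ s with x ∈ N y, c * w x * (‖f y‖ ^ 2 / w y) := by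
        refine Finset.sum_comm' fun x y => ?_
        simp only [Finset.mem_biUnion, Finset.mem_filter, hN, G.adj_comm y x]
        exact ⟨fun h => ⟨h, x, h⟩, fun h => h.1⟩
    _ ≤ ∑ y ∈ s.biUnion N, ∑ x ∈ N y, c * w x * (‖f y‖ ^ 2 / w y) := by
        refine Finset.sum_le_sum fun y _ => ?_
        refine Finset.sum_le_sum_of_subset_of_nonneg (fun x hx => (Finset.mem_filter.1 hx).2)
          fun x _ _ => hnn x y
    _ ≤ ∑ y ∈ s.biUnion N, c ^ 2 * ‖f y‖ ^ 2 := by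
        refine Finset.sum_le_sum fun y _ => ?_
        rw [← Finset.sum_mul, ← Finset.mul_sum]
        have hy := (hw y).ne'
        have h0 : 0 ≤ ‖f y‖ ^ 2 / w y := div_nonneg (sq_nonneg _) (hw y).le
        calc c * (∑ x ∈ N y, w x) * (‖f y‖ ^ 2 / w y)
            ≤ c * (c * w y) * (‖f y‖ ^ 2 / w y) := by gcongr; exact hsum y
          _ = c ^ 2 * ‖f y‖ ^ 2 := by field_simp
    _ ≤ (c * ‖f‖) ^ 2 := by
        rw [← Finset.mul_sum, mul_pow]
        gcongr
        have := lp.sum_rpow_le_norm_rpow (p := 2) (by simp) f (s.biUnion N)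
        simpa only [hpow] using this

end SchurTest

/-- Kesten's upper bound for the norm of the adjacency operator of the tree of degree `Q`. -/
lemma IsCayleyTree.norm_adjacencyOp_le {Q : ℕ} (hQ : 2 ≤ Q) {V : Type} {G : SimpleGraph V}
    (hG : IsCayleyTree G Q) {A : L2 V →L[ℂ] L2 V} (hA : IsAdjacencyOp G A)
    (hsa : IsSelfAdjoint A) : ‖A‖ ≤ 2 * Real.sqrt ((Q : ℝ) - 1) := by
  have hQ' : (1 : ℝ) ≤ Q - 1 := by
    have : (2 : ℝ) ≤ Q := by exact_mod_cast hQ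
    linarith
  have hs : 1 ≤ Real.sqrt ((Q : ℝ) - 1) := Real.one_le_sqrt.2 hQ'
  have hfin : ∀ x, (G.neighborSet x).Finite := fun x =>
    Set.finite_of_ncard_ne_zero (by rw [hG.deg x]; omega)
  obtain ⟨o⟩ := hG.conn.nonempty
  refine hA.norm_le_of_weight hsa (fun x => (hfin x).toFinset) (fun x y => by simp)
    (fun x => (Real.sqrt ((Q : ℝ) - 1))⁻¹ ^ G.dist o x) (fun x => by positivity) (by positivity)
    fun x => ?_
  refine hG.sum_adj_weight_le hs (Real.mul_self_sqrt (by linarith)) o x _ (fun y => by simp) ?_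
  rw [← Set.ncard_eq_toFinset_card _ (hfin x), hG.deg x]

section Projection

variable {V : Type} {P : Set V → (L2 V →L[ℂ] L2 V)}

lemma IsProjFamily.mul_self (hP : IsProjFamily P) (S : Set V) : P S * P S = P S := by
  ext f x
  simp only [mul_apply_eq_comp, hP S]
  split_ifs <;> rfl

lemma IsProjFamily.isSelfAdjoint (hP : IsProjFamily P) (S : Set V) : IsSelfAdjoint (P S) := by
  rw [ContinuousLinearMap.isSelfAdjoint_iff_isSymmetric]
  intro f g
  simp only [ContinuousLinearMap.coe_coe, lp.inner_eq_tsum]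
  refine tsum_congr fun x => ?_
  rw [hP S f x, hP S g x]
  split_ifs <;> simp

end Projection

/-- The secular equation for a loop perturbation of an operator, above its norm. -/
lemma IsProjFamily.norm_compress_resR_eq_one_iff {V : Type} [Nonempty V] {A : L2 V →L[ℂ] L2 V}
    (hsa : IsSelfAdjoint A) {P : Set V → (L2 V →L[ℂ] L2 V)} (hP : IsProjFamily P) (S : Set V)
    {l : ℝ} (hl : ‖A‖ < l) : ‖P S ∘L ResR A l ∘L P S‖ = 1 ↔ l = ‖A + P S‖ := by
  have : Nontrivial (L2 V) := by
    obtain ⟨o⟩ := ‹Nonempty V›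
    refine ⟨delta o, 0, fun h => ?_⟩
    have := congrArg (fun f : L2 V => (f : ∀ _ : V, ℂ) o) h
    simp [delta] at this
  rw [← hsa.norm_compress_inverse_eq_one_iff (hP.isSelfAdjoint S) (hP.mul_self S) hl, mul_assoc]
  rfl

/-- **Theorem 3.2 (the secular equation).** Let `A` be the adjacency operator of `𝔾^Q`,
`S ⊆ V`, and `A_Y = A + P_{ℓ²(S)}` the adjacency of the graph with one self-loop added at
each vertex of `S`.  On `(2√(Q−1), ∞)` the secular equation
`‖P_{ℓ²(S)} R_A(λ) P_{ℓ²(S)}‖ = 1` has at most one solution; any solution equals `‖A_Y‖`;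
conversely, if `‖A_Y‖ > 2√(Q−1)` then `λ* = ‖A_Y‖` solves the secular equation. -/
theorem secular_equation_norm (Q : ℕ) (hQ : 3 ≤ Q)
    {V : Type} (G : SimpleGraph V) (hG : IsCayleyTree G Q)
    (A : L2 V →L[ℂ] L2 V) (hA : IsAdjacencyOp G A) (hsa : IsSelfAdjoint A)
    (P : Set V → (L2 V →L[ℂ] L2 V)) (hP : IsProjFamily P)
    (S : Set V) :
    (∀ l m : ℝ, 2 * Real.sqrt ((Q : ℝ) - 1) < l → 2 * Real.sqrt ((Q : ℝ) - 1) < m →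
      ‖P S ∘L ResR A l ∘L P S‖ = 1 → ‖P S ∘L ResR A m ∘L P S‖ = 1 → l = m)
    ∧ (∀ l : ℝ, 2 * Real.sqrt ((Q : ℝ) - 1) < l →
      ‖P S ∘L ResR A l ∘L P S‖ = 1 → l = ‖A + P S‖)
    ∧ (2 * Real.sqrt ((Q : ℝ) - 1) < ‖A + P S‖ →
      ‖P S ∘L ResR A ‖A + P S‖ ∘L P S‖ = 1) := by
  have := hG.conn.nonempty
  have hnorm := hG.norm_adjacencyOp_le (by omega) hA hsa
  have key {l : ℝ} (hl : 2 * Real.sqrt ((Q : ℝ) - 1) < l) :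
      ‖P S ∘L ResR A l ∘L P S‖ = 1 ↔ l = ‖A + P S‖ :=
    hP.norm_compress_resR_eq_one_iff hsa S (hnorm.trans_lt hl)
  exact ⟨fun l m hl hm h h' => ((key hl).1 h).trans ((key hm).1 h').symm,
    fun l hl => (key hl).1, fun h => (key h).2 rfl⟩
end
end

section
/- Let Q ≥ 3 be an integer and let A_X := A_{𝔾^Q} + P_{ℓ²({0})} be the adjacency operator of the homogeneous Cayley tree of degree Q perturbed by a single self-loop at a fixed root 0. If Q = 3, then ‖A_X‖ = 22/(1 + 3√5) > 2√2 = ‖A_{𝔾^3}‖. If Q ≥ 4, then ‖A_X‖ = 2√(Q−1) = ‖A_{𝔾^Q}‖. -/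
open Filter MeasureTheory Set
open scoped Topology Classical ENNReal

noncomputable section

/-- **Schur test** for the adjacency operator of a locally finite graph, loops allowed: a positive
supersolution bounds the norm. -/
theorem norm_le_of_supersolution {V : Type} (B : L2 V →L[ℂ] L2 V) (N : V → Finset V)
    (hN : ∀ x y, y ∈ N x ↔ x ∈ N y)
    (hB : ∀ (f : L2 V) (x : V), (B f : ∀ _ : V, ℂ) x = ∑ y ∈ N x, (f : ∀ _ : V, ℂ) y)
    (φ : V → ℝ) (hφ : ∀ x, 0 < φ x) (C : ℝ) (hC : 0 ≤ C)
    (h : ∀ x, ∑ y ∈ N x, φ y ≤ C * φ x) : ‖B‖ ≤ C := by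
  refine B.opNorm_le_bound hC fun f => ?_
  refine lp.norm_le_of_forall_sum_le (by norm_num) (by positivity) fun s => ?_
  simp only [ENNReal.toReal_ofNat, Real.rpow_ofNat]
  have pointwise : ∀ x, ‖(B f : ∀ _ : V, ℂ) x‖ ^ 2
      ≤ C * (φ x * ∑ y ∈ N x, ‖(f : ∀ _ : V, ℂ) y‖ ^ 2 / φ y) := by
    intro x
    have h1 : ‖(B f : ∀ _ : V, ℂ) x‖ ≤ ∑ y ∈ N x, ‖(f : ∀ _ : V, ℂ) y‖ := by
      rw [hB]; exact norm_sum_le _ _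
    have h2 : (∑ y ∈ N x, ‖(f : ∀ _ : V, ℂ) y‖) ^ 2
        ≤ (∑ y ∈ N x, φ y) * ∑ y ∈ N x, ‖(f : ∀ _ : V, ℂ) y‖ ^ 2 / φ y :=
      Finset.sum_sq_le_sum_mul_sum_of_sq_le_mul _ (fun y _ => (hφ y).le)
        (fun y _ => div_nonneg (sq_nonneg _) (hφ y).le)
        (fun y _ => by have := (hφ y).ne'; exact le_of_eq (by field_simp))
    calc _ ≤ (∑ y ∈ N x, ‖(f : ∀ _ : V, ℂ) y‖) ^ 2 := by gcongr
      _ ≤ _ := h2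
      _ ≤ (C * φ x) * ∑ y ∈ N x, ‖(f : ∀ _ : V, ℂ) y‖ ^ 2 / φ y := by
        gcongr
        · exact Finset.sum_nonneg fun y _ => div_nonneg (sq_nonneg _) (hφ y).le
        · exact h x
      _ = _ := by ring
  have swap : ∑ x ∈ s, φ x * ∑ y ∈ N x, ‖(f : ∀ _ : V, ℂ) y‖ ^ 2 / φ y
      = ∑ y ∈ s.biUnion N, ‖(f : ∀ _ : V, ℂ) y‖ ^ 2 / φ y * ∑ x ∈ N y with x ∈ s, φ x := by
    simp_rw [Finset.mul_sum]
    rw [Finset.sum_comm' (t' := s.biUnion N) (s' := fun y => {x ∈ N y | x ∈ s})]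
    · exact Finset.sum_congr rfl fun y _ => Finset.sum_congr rfl fun x _ => mul_comm _ _
    · intro x y
      simp only [Finset.mem_filter, Finset.mem_biUnion]
      constructor
      · rintro ⟨hx, hy⟩
        exact ⟨⟨(hN x y).1 hy, hx⟩, x, hx, hy⟩
      · rintro ⟨⟨hy, hx⟩, -⟩
        exact ⟨hx, (hN x y).2 hy⟩
  calc ∑ x ∈ s, ‖(B f : ∀ _ : V, ℂ) x‖ ^ 2
      ≤ ∑ x ∈ s, C * (φ x * ∑ y ∈ N x, ‖(f : ∀ _ : V, ℂ) y‖ ^ 2 / φ y) :=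
        Finset.sum_le_sum fun x _ => pointwise x
    _ = C * ∑ y ∈ s.biUnion N,
          ‖(f : ∀ _ : V, ℂ) y‖ ^ 2 / φ y * ∑ x ∈ N y with x ∈ s, φ x := by
        rw [← Finset.mul_sum, swap]
    _ ≤ C * ∑ y ∈ s.biUnion N, ‖(f : ∀ _ : V, ℂ) y‖ ^ 2 / φ y * (C * φ y) := by
        gcongr with y
        · exact div_nonneg (sq_nonneg _) (hφ y).le
        · exact (Finset.sum_le_sum_of_subset_of_nonneg (Finset.filter_subset _ _)
            fun x _ _ => (hφ x).le).trans (h y)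
    _ = C ^ 2 * ∑ y ∈ s.biUnion N, ‖(f : ∀ _ : V, ℂ) y‖ ^ 2 := by
        rw [Finset.mul_sum, Finset.mul_sum]
        refine Finset.sum_congr rfl fun y _ => ?_
        have := (hφ y).ne'
        field_simp
    _ ≤ C ^ 2 * ‖f‖ ^ 2 := by
        gcongr
        simpa using lp.sum_rpow_le_norm_rpow (p := 2) (by norm_num) f (s.biUnion N)
    _ = (C * ‖f‖) ^ 2 := by ring

/-- Testing the quadratic form of a (generalised) adjacency operator on a finitely supported
nonnegative function bounds its norm from below. -/
theorem quadratic_form_le_norm {V : Type} (B : L2 V →L[ℂ] L2 V) (N : V → Finset V)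
    (hB : ∀ (f : L2 V) (x : V), (B f : ∀ _ : V, ℂ) x = ∑ y ∈ N x, (f : ∀ _ : V, ℂ) y)
    (φ : V → ℝ) (U : Finset V) :
    ∑ x ∈ U, φ x * ∑ y ∈ N x with y ∈ U, φ y ≤ ‖B‖ * ∑ x ∈ U, φ x ^ 2 := by
  set f : L2 V := ∑ x ∈ U, lp.single 2 x (φ x : ℂ) with hf
  have hfy : ∀ y, (f : ∀ _ : V, ℂ) y = if y ∈ U then (φ y : ℂ) else 0 := by
    intro y
    rw [hf, lp.coeFn_sum, Finset.sum_apply]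
    simp [lp.single_apply, Pi.single_apply]
  have hnorm : ‖f‖ ^ 2 = ∑ x ∈ U, φ x ^ 2 := by
    simpa using lp.norm_sum_single (p := 2) (E := fun _ : V => ℂ) (by norm_num)
      (fun x => (φ x : ℂ)) U
  have hinner : inner ℂ f (B f)
      = ((∑ x ∈ U, φ x * ∑ y ∈ N x with y ∈ U, φ y : ℝ) : ℂ) := by
    conv_lhs => rw [hf, sum_inner]
    push_cast
    refine Finset.sum_congr rfl fun x _ => ?_
    rw [lp.inner_single_left, ← hf, hB]
    simp [hfy, Finset.sum_filter, mul_comm]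
  calc _ ≤ ‖inner ℂ f (B f)‖ := by
        rw [hinner, Complex.norm_real]; exact le_abs_self _
    _ ≤ ‖f‖ * ‖B f‖ := norm_inner_le_norm _ _
    _ ≤ ‖f‖ * (‖B‖ * ‖f‖) := by gcongr; exact B.le_opNorm f
    _ = ‖B‖ * ∑ x ∈ U, φ x ^ 2 := by rw [← hnorm]; ring

theorem IsAdjacencyOp.apply {V : Type} {G : SimpleGraph V} [G.LocallyFinite]
    {A : L2 V →L[ℂ] L2 V} (hA : IsAdjacencyOp G A) (hsa : IsSelfAdjoint A) (f : L2 V) (x : V) :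
    (A f : ∀ _ : V, ℂ) x = ∑ y ∈ G.neighborFinset x, (f : ∀ _ : V, ℂ) y := by
  have hdelta : A (delta x) = ∑ y ∈ G.neighborFinset x, lp.single 2 y (1 : ℂ) := by
    ext z
    rw [lp.coeFn_sum, Finset.sum_apply]
    have := hA z x
    rw [entry] at this
    rw [this]
    simp [lp.single_apply, Pi.single_apply, G.adj_comm]
  calc (A f : ∀ _ : V, ℂ) x = inner ℂ (delta x) (A f) := by
        rw [delta]; erw [lp.inner_single_left]; simp
    _ = inner ℂ (A (delta x)) f := (hsa.isSymmetric _ _).symm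
    _ = _ := by
        rw [hdelta, sum_inner]
        refine Finset.sum_congr rfl fun y _ => ?_
        rw [lp.inner_single_left]; simp

/-- The neighbours of `x` once a self-loop is added at `root`. -/
def loopNeighbors {V : Type} (G : SimpleGraph V) [G.LocallyFinite] (root x : V) : Finset V :=
  if x = root then insert root (G.neighborFinset x) else G.neighborFinset x

theorem mem_loopNeighbors {V : Type} {G : SimpleGraph V} [G.LocallyFinite] {root x y : V} :
    y ∈ loopNeighbors G root x ↔ G.Adj x y ∨ x = root ∧ y = root := by
  unfold loopNeighbors
  split_ifs with h <;> simp [h, or_comm]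

theorem sum_loopNeighbors {V M : Type} [AddCommMonoid M] (G : SimpleGraph V) [G.LocallyFinite]
    (root x : V) (φ : V → M) :
    ∑ y ∈ loopNeighbors G root x, φ y
      = (if x = root then φ x else 0) + ∑ y ∈ G.neighborFinset x, φ y := by
  unfold loopNeighbors
  split_ifs with h
  · subst h; rw [Finset.sum_insert (by simp)]
  · simp

theorem add_proj_apply {V : Type} {G : SimpleGraph V} [G.LocallyFinite]
    {A : L2 V →L[ℂ] L2 V} (hA : IsAdjacencyOp G A) (hsa : IsSelfAdjoint A)
    {P : Set V → (L2 V →L[ℂ] L2 V)} (hP : IsProjFamily P) (root : V) (f : L2 V) (x : V) :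
    ((A + P {root}) f : ∀ _ : V, ℂ) x
      = ∑ y ∈ loopNeighbors G root x, (f : ∀ _ : V, ℂ) y := by
  rw [sum_loopNeighbors, _root_.add_apply, lp.coeFn_add, Pi.add_apply,
    hA.apply hsa, hP, add_comm]
  simp

namespace IsCayleyTree

variable {V : Type} {G : SimpleGraph V} {Q : ℕ}

theorem existsUnique_parent (hG : IsCayleyTree G Q) {root x : V} {n : ℕ}
    (hx : G.dist root x = n + 1) : ∃! y, G.Adj x y ∧ G.dist root y = n := by
  obtain ⟨p, hp⟩ := hG.conn.exists_walk_length_eq_dist root x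
  have hnil : ¬ p.Nil := by
    rw [← SimpleGraph.Walk.length_eq_zero_iff]; omega
  have hadj := p.adj_penultimate hnil
  refine ⟨p.penultimate, ⟨hadj.symm, ?_⟩, ?_⟩
  · have h1 : G.dist root p.penultimate ≤ p.dropLast.length := SimpleGraph.dist_le _
    have h2 : G.dist root x ≤ G.dist root p.penultimate + 1 := by
      rw [← SimpleGraph.dist_eq_one_iff_adj.2 hadj]
      exact hG.conn.dist_triangle
    have h3 : p.dropLast.length + 1 = p.length := by
      rw [← SimpleGraph.Walk.length_concat _ hadj, p.concat_dropLast hadj]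
    omega
  · rintro z ⟨hz, hzn⟩
    obtain ⟨q, hq⟩ := hG.conn.exists_walk_length_eq_dist root z
    have hpath : (q.concat hz.symm).IsPath :=
      SimpleGraph.Walk.isPath_of_length_eq_dist _ (by simp; omega)
    have heq : q.concat hz.symm = p := congrArg Subtype.val <|
      (hG.acyc.subsingleton_path root x).elim ⟨_, hpath⟩ ⟨p, p.isPath_of_length_eq_dist hp⟩
    rw [← heq, SimpleGraph.Walk.penultimate_concat]

variable [G.LocallyFinite]

theorem degree_eq (hG : IsCayleyTree G Q) (x : V) : Finset.card (G.neighborFinset x) = Q := by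
  rw [← hG.deg x, ← Set.ncard_coe_finset, SimpleGraph.coe_neighborFinset]

theorem card_parents (hG : IsCayleyTree G Q) {root x : V} {n : ℕ}
    (hx : G.dist root x = n + 1) : Finset.card {y ∈ G.neighborFinset x | G.dist root y = n} = 1 := by
  obtain ⟨p, hp, huniq⟩ := hG.existsUnique_parent hx
  rw [Finset.card_eq_one]
  refine ⟨p, Finset.ext fun y => ?_⟩
  simp only [Finset.mem_filter, SimpleGraph.mem_neighborFinset, Finset.mem_singleton]
  exact ⟨huniq y, fun h => h ▸ hp⟩

theorem card_children (hG : IsCayleyTree G Q) {root x : V} {n : ℕ}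
    (hx : G.dist root x = n + 1) :
    Finset.card {y ∈ G.neighborFinset x | G.dist root y = n + 2} + 1 = Q := by
  rw [← hG.degree_eq x, ← hG.card_parents hx, add_comm,
    ← Finset.card_filter_add_card_filter_not (s := G.neighborFinset x)
      (fun y => G.dist root y = n)]
  congr 2
  refine Finset.filter_congr fun y hy => ?_
  have := SimpleGraph.IsTree.dist_eq_dist_add_one_of_adj ⟨hG.conn, hG.acyc⟩ root
    ((G.mem_neighborFinset x y).1 hy)
  omega

theorem sum_pow_dist_neighbors_root (hG : IsCayleyTree G Q) (root : V) (c : ℝ) :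
    ∑ y ∈ G.neighborFinset root, c ^ G.dist root y = Q * c := by
  rw [Finset.sum_congr rfl (g := fun _ => c), Finset.sum_const, hG.degree_eq, nsmul_eq_mul]
  intro y hy
  rw [SimpleGraph.dist_eq_one_iff_adj.2 ((G.mem_neighborFinset root y).1 hy), pow_one]

theorem sum_pow_dist_neighbors (hG : IsCayleyTree G Q) {root x : V} {n : ℕ}
    (hx : G.dist root x = n + 1) (c : ℝ) :
    ∑ y ∈ G.neighborFinset x, c ^ G.dist root y = c ^ n + ((Q : ℝ) - 1) * c ^ (n + 2) := by
  have hfil : {y ∈ G.neighborFinset x | ¬ G.dist root y = n}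
      = {y ∈ G.neighborFinset x | G.dist root y = n + 2} := by
    refine Finset.filter_congr fun y hy => ?_
    have := SimpleGraph.IsTree.dist_eq_dist_add_one_of_adj ⟨hG.conn, hG.acyc⟩ root
      ((G.mem_neighborFinset x y).1 hy)
    omega
  have hconst : ∀ k, ∑ y ∈ G.neighborFinset x with G.dist root y = k, c ^ G.dist root y
      = Finset.card {y ∈ G.neighborFinset x | G.dist root y = k} * c ^ k := by
    intro k
    rw [← nsmul_eq_mul, ← Finset.sum_const]
    exact Finset.sum_congr rfl fun y hy => by rw [(Finset.mem_filter.1 hy).2]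
  rw [← Finset.sum_filter_add_sum_filter_not _ (fun y => G.dist root y = n), hfil, hconst, hconst,
    hG.card_parents hx]
  have : (Q : ℝ) = Finset.card {y ∈ G.neighborFinset x | G.dist root y = n + 2} + 1 := by
    exact_mod_cast (hG.card_children hx).symm
  rw [this]; push_cast; ring

theorem finite_sphere (hG : IsCayleyTree G Q) (root : V) (n : ℕ) :
    {x | G.dist root x = n}.Finite := by
  induction n with
  | zero =>
    refine (Set.finite_singleton root).subset fun x hx => ?_
    exact (hG.conn.dist_eq_zero_iff.1 hx).symm
  | succ n ih =>
    refine (ih.biUnion fun x _ => (G.neighborFinset x).finite_toSet).subset fun x hx => ?_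
    obtain ⟨y, ⟨hxy, hy⟩, -⟩ := hG.existsUnique_parent hx
    exact Set.mem_biUnion hy (by simpa using hxy.symm)

/-- The vertices at distance `n` from `root`. -/
def sphere (hG : IsCayleyTree G Q) (root : V) (n : ℕ) : Finset V :=
  (hG.finite_sphere root n).toFinset

theorem mem_sphere (hG : IsCayleyTree G Q) {root x : V} {n : ℕ} :
    x ∈ hG.sphere root n ↔ G.dist root x = n := by
  simp [sphere]

theorem sphere_zero (hG : IsCayleyTree G Q) (root : V) : hG.sphere root 0 = {root} := by
  ext x
  rw [mem_sphere, hG.conn.dist_eq_zero_iff, Finset.mem_singleton, eq_comm]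

theorem card_sphere (hG : IsCayleyTree G Q) (root : V) (n : ℕ) :
    (Finset.card (hG.sphere root (n + 1)) : ℝ) = Q * ((Q : ℝ) - 1) ^ n := by
  induction n with
  | zero =>
    have : hG.sphere root (0 + 1) = G.neighborFinset root := by
      ext x
      rw [mem_sphere, SimpleGraph.mem_neighborFinset, zero_add, SimpleGraph.dist_eq_one_iff_adj]
    rw [this, hG.degree_eq, pow_zero, mul_one]
  | succ n ih =>
    have hdc := Finset.sum_card_bipartiteAbove_eq_sum_card_bipartiteBelow
      (s := hG.sphere root (n + 1)) (t := hG.sphere root (n + 2)) G.Adj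
    have hparent : ∀ y ∈ hG.sphere root (n + 2),
        Finset.card ((hG.sphere root (n + 1)).bipartiteBelow G.Adj y) = 1 := by
      intro y hy
      refine Eq.trans (congrArg Finset.card ?_) (hG.card_parents (hG.mem_sphere.1 hy))
      ext x
      simp [Finset.bipartiteBelow, mem_sphere, G.adj_comm, and_comm]
    have hchild : ∀ x ∈ hG.sphere root (n + 1),
        (Finset.card ((hG.sphere root (n + 2)).bipartiteAbove G.Adj x) : ℝ) = (Q : ℝ) - 1 := by
      intro x hx
      rw [eq_sub_iff_add_eq]
      norm_cast
      refine Eq.trans (congrArg (Finset.card · + 1) ?_) (hG.card_children (hG.mem_sphere.1 hx))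
      ext y
      simp [Finset.bipartiteAbove, mem_sphere, and_comm]
    rw [Finset.sum_congr rfl hparent, Finset.sum_const, smul_eq_mul, mul_one] at hdc
    rw [← hdc]
    push_cast
    rw [Finset.sum_congr rfl hchild, Finset.sum_const, nsmul_eq_mul, ih]
    ring

theorem sum_biUnion_sphere (hG : IsCayleyTree G Q) (root : V) (s : Finset ℕ) (g : V → ℝ) :
    ∑ x ∈ s.biUnion (hG.sphere root), g x = ∑ n ∈ s, ∑ x ∈ hG.sphere root n, g x := by
  refine Finset.sum_biUnion fun m _ n _ hmn => ?_
  rw [Function.onFun, Finset.disjoint_left]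
  intro x hm hn
  exact hmn ((hG.mem_sphere.1 hm).symm.trans (hG.mem_sphere.1 hn))

/-- Upper bound from the radial supersolution `c ^ dist root x`. -/
theorem norm_le (hG : IsCayleyTree G Q) (root : V) (B : L2 V →L[ℂ] L2 V)
    (hB : ∀ (f : L2 V) (x : V),
      (B f : ∀ _ : V, ℂ) x = ∑ y ∈ loopNeighbors G root x, (f : ∀ _ : V, ℂ) y)
    {c C : ℝ} (hc : 0 < c) (hroot : 1 + Q * c ≤ C) (hstep : 1 + ((Q : ℝ) - 1) * c ^ 2 ≤ C * c) :
    ‖B‖ ≤ C := by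
  have hC : 0 ≤ C := le_trans (by positivity) hroot
  refine norm_le_of_supersolution B (loopNeighbors G root) (fun x y => ?_) hB
    (fun x => c ^ G.dist root x) (fun x => by positivity) C hC fun x => ?_
  · rw [mem_loopNeighbors, mem_loopNeighbors, G.adj_comm, and_comm]
  · rw [sum_loopNeighbors]
    split_ifs with hx
    · subst hx
      rw [hG.sum_pow_dist_neighbors_root]
      simpa using hroot
    · obtain ⟨n, hn⟩ := Nat.exists_eq_succ_of_ne_zero
        (hG.conn.pos_dist_of_ne (Ne.symm hx)).ne'
      rw [hG.sum_pow_dist_neighbors hn, hn, zero_add]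
      calc c ^ n + ((Q : ℝ) - 1) * c ^ (n + 2) = c ^ n * (1 + ((Q : ℝ) - 1) * c ^ 2) := by ring
        _ ≤ c ^ n * (C * c) := by gcongr
        _ = C * c ^ (n + 1) := by ring

/-- Lower bound from the truncated radial test function `c ^ dist root x`. -/
theorem radial_quadratic_form_le (hG : IsCayleyTree G Q) (root : V) (B : L2 V →L[ℂ] L2 V)
    (hB : ∀ (f : L2 V) (x : V),
      (B f : ∀ _ : V, ℂ) x = ∑ y ∈ loopNeighbors G root x, (f : ∀ _ : V, ℂ) y)
    {c C : ℝ} (hc : 0 < c) (hstep : 1 + ((Q : ℝ) - 1) * c ^ 2 = C * c) (N : ℕ) :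
    1 + Q * c + C * ∑ n ∈ Finset.range N, Q * ((Q : ℝ) - 1) ^ n * c ^ (2 * (n + 1))
      ≤ ‖B‖ * (1 + ∑ n ∈ Finset.range (N + 1),
          Q * ((Q : ℝ) - 1) ^ n * c ^ (2 * (n + 1))) := by
  set U := (Finset.range (N + 2)).biUnion (hG.sphere root) with hU
  have key := quadratic_form_le_norm B _ hB (fun x => c ^ G.dist root x) U
  have hnorm : ∑ x ∈ U, (c ^ G.dist root x) ^ 2
      = 1 + ∑ n ∈ Finset.range (N + 1), Q * ((Q : ℝ) - 1) ^ n * c ^ (2 * (n + 1)) := by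
    rw [hU, sum_biUnion_sphere, Finset.sum_range_succ', hG.sphere_zero, add_comm]
    congr 1
    · simp
    · refine Finset.sum_congr rfl fun n _ => ?_
      rw [← hG.card_sphere root, ← nsmul_eq_mul, ← Finset.sum_const]
      refine Finset.sum_congr rfl fun x hx => ?_
      rw [hG.mem_sphere.1 hx]; ring
  rw [hnorm] at key
  refine le_trans ?_ key
  have hsub : (Finset.range (N + 1)).biUnion (hG.sphere root) ⊆ U :=
    Finset.biUnion_subset_biUnion_of_subset_left _ (Finset.range_subset_range.2 (by omega))
  refine le_trans (le_of_eq ?_) (Finset.sum_le_sum_of_subset_of_nonneg hsub fun x _ _ =>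
    mul_nonneg (by positivity) (Finset.sum_nonneg fun y _ => by positivity))
  have hfull : ∀ x ∈ (Finset.range (N + 1)).biUnion (hG.sphere root),
      {y ∈ loopNeighbors G root x | y ∈ U} = loopNeighbors G root x := by
    intro x hx
    refine Finset.filter_true_of_mem fun y hy => ?_
    simp only [hU, Finset.mem_biUnion, Finset.mem_range, mem_sphere, exists_eq_right'] at hx ⊢
    rcases mem_loopNeighbors.1 hy with h | ⟨-, rfl⟩
    · have := SimpleGraph.IsTree.dist_eq_dist_add_one_of_adj ⟨hG.conn, hG.acyc⟩ root h
      omega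
    · simp
  rw [Finset.sum_congr rfl fun x hx => congrArg (fun s => c ^ G.dist root x *
      ∑ y ∈ s, c ^ G.dist root y) (hfull x hx), sum_biUnion_sphere,
    Finset.sum_range_succ', hG.sphere_zero, add_comm]
  congr 1
  · rw [Finset.mul_sum]
    refine Finset.sum_congr rfl fun n _ => ?_
    rw [← hG.card_sphere root, mul_left_comm, ← nsmul_eq_mul, ← Finset.sum_const]
    refine Finset.sum_congr rfl fun x hx => ?_
    have hx' := hG.mem_sphere.1 hx
    have hne : x ≠ root := by
      rintro rfl; simp at hx'
    rw [sum_loopNeighbors, if_neg hne, hG.sum_pow_dist_neighbors hx', hx']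
    linear_combination (-c ^ (2 * n + 1)) * hstep
  · simp [sum_loopNeighbors, hG.sum_pow_dist_neighbors_root]

end IsCayleyTree

theorem golden_norm_eq : 22 / (1 + 3 * √5) = 1 + 3 * ((√5 - 1) / 2) := by
  have h5 : √5 ^ 2 = 5 := Real.sq_sqrt (by norm_num)
  rw [div_eq_iff (by positivity)]
  linear_combination (-9 / 2) * h5

theorem two_sqrt_two_lt : 2 * √2 < 22 / (1 + 3 * √5) := by
  rw [golden_norm_eq]
  have h2 : √2 < 1.415 := by rw [Real.sqrt_lt' (by norm_num)]; norm_num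
  have h5 : 2.236 < √5 := by rw [Real.lt_sqrt (by norm_num)]; norm_num
  linarith

namespace IsCayleyTree

variable {V : Type} {G : SimpleGraph V} {Q : ℕ} [G.LocallyFinite]

theorem norm_eq_of_three (hG : IsCayleyTree G 3) (root : V) (B : L2 V →L[ℂ] L2 V)
    (hB : ∀ (f : L2 V) (x : V),
      (B f : ∀ _ : V, ℂ) x = ∑ y ∈ loopNeighbors G root x, (f : ∀ _ : V, ℂ) y) :
    ‖B‖ = 22 / (1 + 3 * √5) := by
  rw [golden_norm_eq]
  have h5 : √5 ^ 2 = 5 := Real.sq_sqrt (by norm_num)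
  have hlt : √5 < 2.3 := by rw [Real.sqrt_lt' (by norm_num)]; norm_num
  have hgt : 2 < √5 := by rw [Real.lt_sqrt (by norm_num)]; norm_num
  set c := (√5 - 1) / 2 with hc
  have hcc : c ^ 2 = 1 - c := by rw [hc]; linear_combination h5 / 4
  have hc0 : 0 < c := by linarith
  have hstep : 1 + (((3 : ℕ) : ℝ) - 1) * c ^ 2 = (1 + 3 * c) * c := by
    push_cast; linear_combination -hcc
  refine le_antisymm (hG.norm_le root B hB hc0 (by norm_num) hstep.le) ?_
  have hbound : ∀ N : ℕ, 1 + 3 * c ≤ ‖B‖ * (1 + 3 * c ^ 2 * (2 * c ^ 2) ^ N) := by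
    intro N
    have key := hG.radial_quadratic_form_le root B hB hc0 hstep N
    rw [Finset.sum_range_succ] at key
    set T := ∑ n ∈ Finset.range N, ((3 : ℕ) : ℝ) * (((3 : ℕ) : ℝ) - 1) ^ n * c ^ (2 * (n + 1))
    have hT : 0 ≤ T := Finset.sum_nonneg fun n _ => by norm_num; positivity
    have hlast : ((3 : ℕ) : ℝ) * (((3 : ℕ) : ℝ) - 1) ^ N * c ^ (2 * (N + 1))
        = 3 * c ^ 2 * (2 * c ^ 2) ^ N := by
      rw [show ((3 : ℕ) : ℝ) - 1 = 2 by norm_num, pow_mul, pow_succ, mul_pow 2 (c ^ 2)]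
      push_cast
      generalize c ^ 2 = d
      ring
    rw [hlast] at key
    have he : 0 ≤ ‖B‖ * (3 * c ^ 2 * (2 * c ^ 2) ^ N) * T := by positivity
    refine le_of_mul_le_mul_right (a := 1 + T) ?_ (by positivity)
    push_cast at key
    nlinarith
  have hlim : Tendsto (fun N : ℕ => ‖B‖ * (1 + 3 * c ^ 2 * (2 * c ^ 2) ^ N)) atTop
      (𝓝 (‖B‖ * (1 + 3 * c ^ 2 * 0))) :=
    (((tendsto_pow_atTop_nhds_zero_of_lt_one (by positivity)
      (by rw [hcc]; linarith)).const_mul _).const_add _).const_mul _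
  simpa using ge_of_tendsto' hlim hbound

theorem norm_eq_of_four_le (hG : IsCayleyTree G Q) (hQ : 4 ≤ Q) (root : V)
    (B : L2 V →L[ℂ] L2 V)
    (hB : ∀ (f : L2 V) (x : V),
      (B f : ∀ _ : V, ℂ) x = ∑ y ∈ loopNeighbors G root x, (f : ∀ _ : V, ℂ) y) :
    ‖B‖ = 2 * √((Q : ℝ) - 1) := by
  have hQ' : (4 : ℝ) ≤ Q := by exact_mod_cast hQ
  set r := √((Q : ℝ) - 1) with hr
  have hr2 : (Q : ℝ) = r ^ 2 + 1 := by rw [hr, Real.sq_sqrt (by linarith)]; ring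
  have hr1 : 1.7 < r := by rw [hr, Real.lt_sqrt (by norm_num)]; norm_num; linarith
  have hr0 : 0 < r := by linarith
  have hstep : 1 + ((Q : ℝ) - 1) * r⁻¹ ^ 2 = 2 * r * r⁻¹ := by
    rw [hr2]; field_simp; norm_num; ring
  refine le_antisymm (hG.norm_le root B hB (inv_pos.2 hr0) ?_ hstep.le) ?_
  · rw [hr2, ← div_eq_mul_inv, ← le_sub_iff_add_le', div_le_iff₀ hr0]
    nlinarith
  · by_contra! hlt
    set q := (Q : ℝ) * r⁻¹ ^ 2 with hq
    have hq0 : 0 < q := by positivity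
    have hterm : ∀ n : ℕ, Q * ((Q : ℝ) - 1) ^ n * r⁻¹ ^ (2 * (n + 1)) = q := by
      intro n
      have h1 : ((Q : ℝ) - 1) * r⁻¹ ^ 2 = 1 := by rw [hr2]; field_simp; norm_num
      calc _ = q * (((Q : ℝ) - 1) * r⁻¹ ^ 2) ^ n := by rw [hq, mul_pow]; ring
        _ = q := by rw [h1, one_pow, mul_one]
    obtain ⟨N, hN⟩ := exists_nat_gt (‖B‖ * (1 + q) / ((2 * r - ‖B‖) * q))
    rw [div_lt_iff₀ (mul_pos (sub_pos.2 hlt) hq0)] at hN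
    have key := hG.radial_quadratic_form_le root B hB (inv_pos.2 hr0) hstep N
    simp only [hterm, Finset.sum_const, Finset.card_range, nsmul_eq_mul] at key
    have h0 : 0 < Q * r⁻¹ := by positivity
    push_cast at key
    nlinarith

end IsCayleyTree

/-- **Example of Section 3.** For the Cayley tree `𝔾^Q` perturbed by a single self-loop at
the root, the norm of the perturbed adjacency `A_X = A + P_{ℓ²({0})}` equals
`22/(1 + 3√5) > 2√2` when `Q = 3`, and it equals the unperturbed norm `2√(Q−1)` when
`Q ≥ 4`. -/
theorem norm_single_loop_perturbation (Q : ℕ) (hQ : 3 ≤ Q)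
    {V : Type} (G : SimpleGraph V) (hG : IsCayleyTree G Q)
    (root : V)
    (A : L2 V →L[ℂ] L2 V) (hA : IsAdjacencyOp G A) (hsa : IsSelfAdjoint A)
    (P : Set V → (L2 V →L[ℂ] L2 V)) (hP : IsProjFamily P) :
    (Q = 3 →
      ‖A + P {root}‖ = 22 / (1 + 3 * Real.sqrt 5) ∧
      2 * Real.sqrt 2 < 22 / (1 + 3 * Real.sqrt 5))
    ∧ (4 ≤ Q → ‖A + P {root}‖ = 2 * Real.sqrt ((Q : ℝ) - 1)) := by
  have hfin : G.LocallyFinite := fun v => by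
    have : (G.neighborSet v).Finite :=
      Set.finite_of_ncard_pos (by rw [hG.deg v]; omega)
    exact this.fintype
  have hB := add_proj_apply hA hsa hP root
  refine ⟨?_, fun h4 => hG.norm_eq_of_four_le h4 root _ hB⟩
  rintro rfl
  exact ⟨hG.norm_eq_of_three root _ hB, two_sqrt_two_lt⟩
end
end

section
/- Let Q be an integer with 3 ≤ Q ≤ 7, λ* := (3−√5)Q/2 + √5 = ‖A_{𝔾^{Q,2}}‖, and a* := a(λ*) where a(λ) = λ(1 − √(1 − 4(Q−1)/λ²))/(2(Q−1)). Then the function v on the vertices of 𝔾^Q defined by v(x) := (a*)^{d(x,Z)} is a generalized Perron–Frobenius eigenvector of A_{𝔾^{Q,2}}: v has strictly positive entries and Σ_y (A_{𝔾^{Q,2}})_{xy} v(y) = λ* v(x) for every vertex x. Moreover, v is unique up to a positive multiplicative constant among generalized Perron–Frobenius eigenvectors of A_{𝔾^{Q,2}}. -/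
open Filter MeasureTheory Set
open scoped Topology Classical ENNReal

noncomputable section

namespace CayleyTreeGeodesic

variable {V : Type} {G : SimpleGraph V} {Z : Set V}

lemma distToSet_le {x y : V} (hy : y ∈ Z) : distToSet G x Z ≤ G.dist x y :=
  Nat.sInf_le ⟨y, hy, rfl⟩

lemma exists_dist_eq_distToSet (hZ : Z.Nonempty) (x : V) :
    ∃ y ∈ Z, G.dist x y = distToSet G x Z := by
  obtain ⟨z, hz⟩ := hZ
  exact Nat.sInf_mem (s := {n : ℕ | ∃ y ∈ Z, G.dist x y = n}) ⟨_, z, hz, rfl⟩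

lemma distToSet_eq_zero_iff (hG : G.Connected) (hZ : Z.Nonempty) {x : V} :
    distToSet G x Z = 0 ↔ x ∈ Z := by
  constructor
  · intro h
    obtain ⟨y, hy, hxy⟩ := exists_dist_eq_distToSet (G := G) hZ x
    rw [h, hG.dist_eq_zero_iff] at hxy
    exact hxy ▸ hy
  · intro h
    have := distToSet_le (G := G) (x := x) h
    simpa using this

lemma distToSet_le_add_one (hG : G.Connected) (hZ : Z.Nonempty) {x y : V} (h : G.Adj x y) :
    distToSet G y Z ≤ distToSet G x Z + 1 := by
  obtain ⟨z, hz, hxz⟩ := exists_dist_eq_distToSet (G := G) hZ x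
  have h1 := distToSet_le (G := G) (x := y) hz
  have h2 := hG.dist_triangle (u := y) (v := x) (w := z)
  have h3 : G.dist y x = 1 := SimpleGraph.dist_eq_one_iff_adj.2 h.symm
  omega

lemma exists_adj_distToSet_add_one (hG : G.Connected) (hZ : Z.Nonempty) {x : V} (hx : x ∉ Z) :
    ∃ p, G.Adj x p ∧ distToSet G x Z = distToSet G p Z + 1 := by
  obtain ⟨z, hz, hxz⟩ := exists_dist_eq_distToSet (G := G) hZ x
  obtain ⟨w, hw⟩ := hG.exists_walk_length_eq_dist x z
  cases w with
  | nil => exact absurd hz hx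
  | cons h t =>
    rename_i p
    refine ⟨p, h, ?_⟩
    have h1 := distToSet_le (G := G) (x := p) hz
    have h2 := SimpleGraph.dist_le t
    have h3 := distToSet_le_add_one hG hZ h.symm
    rw [SimpleGraph.Walk.length_cons] at hw
    omega

/-- Away from `x`, a vertex no farther from `Z` than `x` is joined to `Z` by edges not
touching `x`. -/
lemma exists_reachable_deleteEdges (hG : G.Connected) (hZ : Z.Nonempty) (x y₁ : V) (n : ℕ) :
    ∀ y, y ≠ x → distToSet G y Z = n → n ≤ distToSet G x Z →
      ∃ z ∈ Z, (G.deleteEdges {s(x, y₁)}).Reachable y z := by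
  induction n with
  | zero =>
    intro y _ hy _
    exact ⟨y, (distToSet_eq_zero_iff hG hZ).1 hy, .rfl⟩
  | succ n ih =>
    intro y hyx hy hn
    have hyZ : y ∉ Z := fun h => by
      rw [(distToSet_eq_zero_iff hG hZ).2 h] at hy
      omega
    obtain ⟨p, hp, hd⟩ := exists_adj_distToSet_add_one hG hZ hyZ
    have hpx : p ≠ x := by
      rintro rfl
      omega
    obtain ⟨z, hz, hr⟩ := ih p hpx (by omega) (by omega)
    refine ⟨z, hz, SimpleGraph.Reachable.trans (SimpleGraph.Adj.reachable ?_) hr⟩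
    rw [SimpleGraph.deleteEdges_adj]
    refine ⟨hp, fun h => ?_⟩
    rw [Set.mem_singleton_iff, Sym2.eq_iff] at h
    rcases h with h | h
    · exact hyx h.1
    · exact hpx h.2

lemma reachable_deleteEdges_of_mem (hZ : (G.induce Z).Connected) {x : V} (hx : x ∉ Z) (y₁ : V)
    {z z' : V} (hz : z ∈ Z) (hz' : z' ∈ Z) :
    (G.deleteEdges {s(x, y₁)}).Reachable z z' := by
  let f : G.induce Z →g G.deleteEdges {s(x, y₁)} :=
    { toFun := Subtype.val
      map_rel' := by
        intro a b hab
        rw [SimpleGraph.deleteEdges_adj]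
        refine ⟨hab, fun h => ?_⟩
        rw [Set.mem_singleton_iff, Sym2.eq_iff] at h
        rcases h with h | h
        · exact hx (h.1 ▸ a.2)
        · exact hx (h.2 ▸ b.2) }
  exact (hZ.preconnected ⟨z, hz⟩ ⟨z', hz'⟩).map f

lemma eq_of_adj_of_distToSet_le (hG : G.Connected) (hac : G.IsAcyclic)
    (hZ : (G.induce Z).Connected) {x y₁ y₂ : V} (hx : x ∉ Z) (h₁ : G.Adj x y₁) (h₂ : G.Adj x y₂)
    (hd₁ : distToSet G y₁ Z ≤ distToSet G x Z) (hd₂ : distToSet G y₂ Z ≤ distToSet G x Z) :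
    y₁ = y₂ := by
  by_contra hne
  have hne' : Z.Nonempty := let ⟨z⟩ := hZ.nonempty; ⟨z, z.2⟩
  have hb := SimpleGraph.isAcyclic_iff_forall_adj_isBridge.1 hac h₁
  obtain ⟨z₁, hz₁, hr₁⟩ := exists_reachable_deleteEdges hG hne' x y₁ _ y₁ h₁.ne' rfl hd₁
  obtain ⟨z₂, hz₂, hr₂⟩ := exists_reachable_deleteEdges hG hne' x y₁ _ y₂ h₂.ne' rfl hd₂
  rw [SimpleGraph.isBridge_iff] at hb
  refine hb ?_
  have h : (G.deleteEdges {s(x, y₁)}).Adj x y₂ := by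
    rw [SimpleGraph.deleteEdges_adj]
    refine ⟨h₂, fun h => ?_⟩
    rw [Set.mem_singleton_iff, Sym2.eq_iff] at h
    rcases h with h | h
    · exact hne h.2.symm
    · exact h₁.ne h.1
  exact h.reachable.trans (hr₂.trans
    ((reachable_deleteEdges_of_mem hZ hx y₁ hz₂ hz₁).trans hr₁.symm))

lemma tsum_neighborSet_eq {x : V} (hfin : (G.neighborSet x).Finite) (f : V → ℝ) :
    ∑' y : G.neighborSet x, f y = ∑ y ∈ hfin.toFinset, f y := by
  rw [← Finset.tsum_subtype' hfin.toFinset f, hfin.coe_toFinset]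

lemma exists_children_of_notMem {Q : ℕ} (hQ : 0 < Q) (hG : IsCayleyTree G Q)
    (hZ : (G.induce Z).Connected) {x p : V} (hp : G.Adj x p)
    (hd : distToSet G x Z = distToSet G p Z + 1) :
    ∃ C : Finset V, (C.card : ℝ) = Q - 1 ∧
      (∀ y, y ∈ C ↔ G.Adj x y ∧ distToSet G y Z = distToSet G x Z + 1) ∧
      ∀ f : V → ℝ, ∑' y : G.neighborSet x, f y = f p + ∑ y ∈ C, f y := by
  have hne : Z.Nonempty := let ⟨z⟩ := hZ.nonempty; ⟨z, z.2⟩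
  have hx : x ∉ Z := fun h => by
    rw [(distToSet_eq_zero_iff hG.conn hne).2 h] at hd
    omega
  have hfin : (G.neighborSet x).Finite := Set.finite_of_ncard_pos (by rw [hG.deg]; exact hQ)
  have hpm : p ∈ hfin.toFinset := by simpa using hp
  refine ⟨hfin.toFinset.erase p, ?_, ?_, ?_⟩
  · have h := Finset.card_erase_add_one hpm
    rw [← Set.ncard_eq_toFinset_card _ hfin, hG.deg] at h
    rw [← h]
    push_cast
    ring
  · intro y
    rw [Finset.mem_erase, hfin.mem_toFinset, SimpleGraph.mem_neighborSet]
    refine ⟨fun hy => ⟨hy.2, ?_⟩, fun hy => ⟨by rintro rfl; omega, hy.1⟩⟩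
    have h1 := distToSet_le_add_one hG.conn hne hy.2
    by_contra h2
    exact hy.1 (eq_of_adj_of_distToSet_le hG.conn hG.acyc hZ hx hy.2 hp (by omega) (by omega))
  · intro f
    rw [tsum_neighborSet_eq hfin, Finset.add_sum_erase _ _ hpm]

lemma exists_children_of_mem {Q : ℕ} (hQ : 0 < Q) (hG : IsCayleyTree G Q)
    (hZ : IsRegularSubtree G Z 2) {x : V} (hx : x ∈ Z) :
    ∃ z₁ z₂ : V, z₁ ≠ z₂ ∧ (∀ y, y ∈ Z ∧ G.Adj x y ↔ y = z₁ ∨ y = z₂) ∧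
      ∃ C : Finset V, (C.card : ℝ) = Q - 2 ∧
      (∀ y, y ∈ C ↔ G.Adj x y ∧ y ∉ Z) ∧
      (∀ y ∈ C, distToSet G y Z = distToSet G x Z + 1) ∧
      ∀ f : V → ℝ, ∑' y : G.neighborSet x, f y = f z₁ + f z₂ + ∑ y ∈ C, f y := by
  have hne : Z.Nonempty := ⟨x, hx⟩
  have hfin : (G.neighborSet x).Finite := Set.finite_of_ncard_pos (by rw [hG.deg]; exact hQ)
  obtain ⟨z₁, z₂, h12, hs⟩ := Set.ncard_eq_two.1 (hZ.2 x hx)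
  have hs' : ∀ y, y ∈ Z ∧ G.Adj x y ↔ y = z₁ ∨ y = z₂ := fun y => by
    have := Set.ext_iff.1 hs y
    simpa using this
  have hm₁ := (hs' z₁).2 (.inl rfl)
  have hm₂ := (hs' z₂).2 (.inr rfl)
  have hz₁ : z₁ ∈ hfin.toFinset := by simpa using hm₁.2
  have hz₂ : z₂ ∈ hfin.toFinset.erase z₁ := by simpa [h12.symm] using hm₂.2
  have hC : ∀ y, y ∈ (hfin.toFinset.erase z₁).erase z₂ ↔ G.Adj x y ∧ y ∉ Z := by
    intro y
    have := hs' y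
    rw [Finset.mem_erase, Finset.mem_erase, hfin.mem_toFinset, SimpleGraph.mem_neighborSet]
    tauto
  refine ⟨z₁, z₂, h12, hs', (hfin.toFinset.erase z₁).erase z₂, ?_, hC, ?_, ?_⟩
  · have h1 := Finset.card_erase_add_one hz₁
    have h2 := Finset.card_erase_add_one hz₂
    rw [← Set.ncard_eq_toFinset_card _ hfin, hG.deg] at h1
    rw [← h1, ← h2]
    push_cast
    ring
  · intro y hy
    rw [hC] at hy
    have h1 := distToSet_le_add_one hG.conn hne hy.1
    have h2 := (distToSet_eq_zero_iff hG.conn hne).2 hx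
    have h3 := (distToSet_eq_zero_iff hG.conn hne).not.2 hy.2
    omega
  · intro f
    rw [tsum_neighborSet_eq hfin, add_assoc, Finset.add_sum_erase _ _ hz₂,
      Finset.add_sum_erase _ _ hz₁]

/-- A positive function on a 2-regular graph which is superharmonic is constant along edges. -/
lemma le_of_adj_of_superharmonic {w : V → ℝ} (hw : ∀ x, 0 < w x)
    (h : ∀ x ∈ Z, ∀ y ∈ Z, G.Adj x y → ∃ y' ∈ Z, G.Adj x y' ∧ w y + w y' ≤ 2 * w x)
    {x y : V} (hx : x ∈ Z) (hy : y ∈ Z) (hxy : G.Adj x y) : w x ≤ w y := by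
  by_contra! hlt
  set δ := w x - w y with hδ
  have key : ∀ n : ℕ, ∀ x ∈ Z, ∀ y ∈ Z, G.Adj x y → δ ≤ w x - w y → n * δ ≤ w x := by
    intro n
    induction n with
    | zero =>
      intro x _ _ _ _ _
      simpa using (hw x).le
    | succ n ih =>
      intro x hx y hy hxy hd
      obtain ⟨y', hy', hadj, hle⟩ := h y hy x hx hxy.symm
      have := ih y hy y' hy' hadj (by linarith)
      push_cast
      linarith
  obtain ⟨n, hn⟩ := exists_nat_gt (w x / δ)
  rw [div_lt_iff₀ (by linarith)] at hn
  linarith [key n x hx y hy hxy le_rfl]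

lemma eq_of_superharmonic (hZ : (G.induce Z).Connected) {w : V → ℝ} (hw : ∀ x, 0 < w x)
    (h : ∀ x ∈ Z, ∀ y ∈ Z, G.Adj x y → ∃ y' ∈ Z, G.Adj x y' ∧ w y + w y' ≤ 2 * w x)
    {x y : V} (hx : x ∈ Z) (hy : y ∈ Z) : w x = w y := by
  obtain ⟨p⟩ := hZ.preconnected ⟨x, hx⟩ ⟨y, hy⟩
  suffices H : ∀ a b : Z, (G.induce Z).Walk a b → w a = w b from H _ _ p
  intro a b q
  induction q with
  | nil => rfl
  | @cons a b c hab _ ih =>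
    have hab' : G.Adj (a : V) b := hab
    exact (le_antisymm (le_of_adj_of_superharmonic hw h a.2 b.2 hab')
      (le_of_adj_of_superharmonic hw h b.2 a.2 hab'.symm)).trans ih

/-- Positive solutions of the eigenvalue equation off `Z` decay no faster than the smaller root
of the characteristic equation. -/
lemma mul_le_of_child {Q : ℕ} (hQ : 1 < Q) (hG : IsCayleyTree G Q)
    (hZ : (G.induce Z).Connected) {l a : ℝ} (ha : ((Q : ℝ) - 1) * a ^ 2 - l * a + 1 = 0)
    (hal : 2 * ((Q : ℝ) - 1) * a ≤ l) {w : V → ℝ} (hw : ∀ x, 0 < w x)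
    (heq : ∀ x ∉ Z, ∑' y : G.neighborSet x, w y = l * w x)
    {x y : V} (hxy : G.Adj x y) (hd : distToSet G y Z = distToSet G x Z + 1) :
    a * w x ≤ w y := by
  have hne : Z.Nonempty := let ⟨z⟩ := hZ.nonempty; ⟨z, z.2⟩
  let R : Set ℝ := {r | ∃ x y, G.Adj x y ∧ distToSet G y Z = distToSet G x Z + 1 ∧ r = w y / w x}
  have hbdd : BddBelow R := by
    refine ⟨0, ?_⟩
    rintro r ⟨x, y, _, _, rfl⟩
    exact (div_pos (hw y) (hw x)).le
  set m := sInf R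
  have hm : ∀ x y, G.Adj x y → distToSet G y Z = distToSet G x Z + 1 → m * w x ≤ w y := by
    intro x y h1 h2
    rw [← le_div_iff₀ (hw x)]
    exact csInf_le hbdd ⟨x, y, h1, h2, rfl⟩
  have hstep : ∀ x y, G.Adj x y → distToSet G y Z = distToSet G x Z + 1 →
      w x ≤ (l - ((Q : ℝ) - 1) * m) * w y := by
    intro x y h1 h2
    obtain ⟨C, hcard, hC, hsum⟩ := exists_children_of_notMem (by omega) hG hZ h1.symm h2
    have hyZ : y ∉ Z := fun h => by
      rw [(distToSet_eq_zero_iff hG.conn hne).2 h] at h2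
      omega
    have h3 := heq y hyZ
    rw [hsum] at h3
    have h4 : C.card • (m * w y) ≤ ∑ u ∈ C, w u :=
      Finset.card_nsmul_le_sum _ _ _ fun u hu => hm y u ((hC u).1 hu).1 ((hC u).1 hu).2
    rw [nsmul_eq_mul, hcard] at h4
    linarith
  have hpos : 0 < l - ((Q : ℝ) - 1) * m :=
    pos_of_mul_pos_left ((hw x).trans_le (hstep x y hxy hd)) (hw y).le
  have hinv : (l - ((Q : ℝ) - 1) * m)⁻¹ ≤ m := by
    refine le_csInf ⟨_, x, y, hxy, hd, rfl⟩ ?_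
    rintro r ⟨x, y, h1, h2, rfl⟩
    rw [le_div_iff₀ (hw x), inv_mul_le_iff₀ hpos]
    exact hstep x y h1 h2
  rw [inv_le_iff_one_le_mul₀ hpos] at hinv
  have ham : a ≤ m := by
    by_contra! hlt
    have hQ' : (0 : ℝ) < (Q : ℝ) - 1 := by
      have : (1 : ℝ) < Q := by exact_mod_cast hQ
      linarith
    nlinarith [mul_pos (sub_pos.2 hlt) hQ', mul_pos (sub_pos.2 hlt) (mul_pos (sub_pos.2 hlt) hQ'),
      mul_nonneg (sub_pos.2 hlt).le (sub_nonneg.2 hal)]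
  exact (mul_le_mul_of_nonneg_right ham (hw x).le).trans (hm x y hxy hd)

lemma pow_distToSet_eigenvector {Q : ℕ} (hQ : 0 < Q) (hG : IsCayleyTree G Q)
    (hZ : IsRegularSubtree G Z 2) {l a : ℝ} (ha : ((Q : ℝ) - 1) * a ^ 2 - l * a + 1 = 0)
    (hl : l = 3 + ((Q : ℝ) - 2) * a) {v : V → ℝ} (hv : ∀ x, v x = a ^ distToSet G x Z) (x : V) :
    (∑' y : G.neighborSet x, v (y : V)) + Z.indicator v x = l * v x := by
  have hne : Z.Nonempty := let ⟨z⟩ := hZ.1.nonempty; ⟨z, z.2⟩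
  by_cases hx : x ∈ Z
  · obtain ⟨z₁, z₂, _, hz, C, hcard, _, hd, hsum⟩ := exists_children_of_mem hQ hG hZ hx
    have hv0 : ∀ z ∈ Z, v z = 1 := fun z h => by
      rw [hv, (distToSet_eq_zero_iff hG.conn hne).2 h, pow_zero]
    have hvC : ∀ y ∈ C, v y = a := fun y hy => by
      rw [hv, hd y hy, (distToSet_eq_zero_iff hG.conn hne).2 hx, zero_add, pow_one]
    rw [hsum, Set.indicator_of_mem hx, hv0 x hx, hv0 z₁ ((hz z₁).2 (.inl rfl)).1,
      hv0 z₂ ((hz z₂).2 (.inr rfl)).1, Finset.sum_congr rfl hvC, Finset.sum_const, nsmul_eq_mul,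
      hcard, hl]
    ring
  · obtain ⟨p, hp, hdp⟩ := exists_adj_distToSet_add_one hG.conn hne hx
    obtain ⟨C, hcard, hC, hsum⟩ := exists_children_of_notMem hQ hG hZ.1 hp hdp
    have hvC : ∀ y ∈ C, v y = a ^ 2 * v p := fun y hy => by
      rw [hv, ((hC y).1 hy).2, hdp, hv p]
      ring
    have hvx : v x = a * v p := by
      rw [hv, hdp, hv p]
      ring
    rw [hsum, Set.indicator_of_notMem hx, Finset.sum_congr rfl hvC, Finset.sum_const, nsmul_eq_mul,
      hcard, hvx]
    linear_combination v p * ha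

lemma eigenvector_eq_mul_pow {Q : ℕ} (hQ : 1 < Q) (hG : IsCayleyTree G Q)
    (hZ : IsRegularSubtree G Z 2) {l a : ℝ} (ha : ((Q : ℝ) - 1) * a ^ 2 - l * a + 1 = 0)
    (hal : 2 * ((Q : ℝ) - 1) * a ≤ l) (hl : l = 3 + ((Q : ℝ) - 2) * a)
    {w : V → ℝ} (hw : ∀ x, 0 < w x)
    (heq : ∀ x, (∑' y : G.neighborSet x, w (y : V)) + Z.indicator w x = l * w x) :
    ∃ c : ℝ, 0 < c ∧ ∀ x, w x = c * a ^ distToSet G x Z := by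
  obtain ⟨z₀, hz₀⟩ : Z.Nonempty := let ⟨z⟩ := hZ.1.nonempty; ⟨z, z.2⟩
  have hne : Z.Nonempty := ⟨z₀, hz₀⟩
  have heq' : ∀ x ∉ Z, ∑' y : G.neighborSet x, w y = l * w x := fun x hx => by
    rw [← heq x, Set.indicator_of_notMem hx, add_zero]
  have hle : ∀ x y, G.Adj x y → distToSet G y Z = distToSet G x Z + 1 → a * w x ≤ w y :=
    fun x y => mul_le_of_child hQ hG hZ.1 ha hal hw heq'
  have hsup : ∀ x ∈ Z, ∀ y ∈ Z, G.Adj x y → ∃ y' ∈ Z, G.Adj x y' ∧ w y + w y' ≤ 2 * w x := by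
    intro x hx y hy hxy
    obtain ⟨z₁, z₂, _, hz, C, hcard, hCm, hd, hsum⟩ := exists_children_of_mem (by omega) hG hZ hx
    have h1 := heq x
    rw [hsum, Set.indicator_of_mem hx] at h1
    have h2 : C.card • (a * w x) ≤ ∑ u ∈ C, w u :=
      Finset.card_nsmul_le_sum _ _ _ fun u hu => hle x u ((hCm u).1 hu).1 (hd u hu)
    rw [nsmul_eq_mul, hcard] at h2
    rw [hl] at h1
    have h3 : w z₁ + w z₂ ≤ 2 * w x := by linarith
    rcases (hz y).1 ⟨hy, hxy⟩ with rfl | rfl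
    · exact ⟨z₂, ((hz z₂).2 (.inr rfl)).1, ((hz z₂).2 (.inr rfl)).2, h3⟩
    · exact ⟨z₁, ((hz z₁).2 (.inl rfl)).1, ((hz z₁).2 (.inl rfl)).2, by linarith⟩
  have hconst : ∀ z ∈ Z, w z = w z₀ := fun z h => eq_of_superharmonic hZ.1 hw hsup h hz₀
  have hchild : ∀ n : ℕ, ∀ x y, distToSet G x Z = n → G.Adj x y →
      distToSet G y Z = distToSet G x Z + 1 → w y = a * w x := by
    intro n
    induction n with
    | zero =>
      intro x y hx hxy hd
      rw [distToSet_eq_zero_iff hG.conn hne] at hx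
      obtain ⟨z₁, z₂, _, hz, C, hcard, hCm, hdC, hsum⟩ := exists_children_of_mem (by omega) hG hZ hx
      have h1 := heq x
      rw [hsum, Set.indicator_of_mem hx, hconst z₁ ((hz z₁).2 (.inl rfl)).1,
        hconst z₂ ((hz z₂).2 (.inr rfl)).1, ← hconst x hx, hl] at h1
      have hyC : y ∈ C := (hCm y).2 ⟨hxy, fun h => by
        rw [(distToSet_eq_zero_iff hG.conn hne).2 h] at hd
        omega⟩
      refine (((Finset.sum_eq_sum_iff_of_le
        (fun u hu => hle x u ((hCm u).1 hu).1 (hdC u hu))).1 ?_) y hyC).symm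
      rw [Finset.sum_const, nsmul_eq_mul, hcard]
      linarith
    | succ n ih =>
      intro x y hx hxy hd
      have hxZ : x ∉ Z := fun h => by
        rw [(distToSet_eq_zero_iff hG.conn hne).2 h] at hx
        omega
      obtain ⟨p, hp, hdp⟩ := exists_adj_distToSet_add_one hG.conn hne hxZ
      obtain ⟨C, hcard, hC, hsum⟩ := exists_children_of_notMem (by omega) hG hZ.1 hp hdp
      have h1 := heq' x hxZ
      have hwx := ih p x (by omega) hp.symm hdp
      rw [hsum] at h1
      refine (((Finset.sum_eq_sum_iff_of_le
        (fun u hu => hle x u ((hC u).1 hu).1 ((hC u).1 hu).2)).1 ?_) y ((hC y).2 ⟨hxy, hd⟩)).symm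
      rw [Finset.sum_const, nsmul_eq_mul, hcard]
      rw [hwx] at h1 ⊢
      linear_combination w p * ha - h1
  refine ⟨w z₀, hw z₀, fun x => ?_⟩
  generalize hn : distToSet G x Z = n
  induction n generalizing x with
  | zero => rw [hconst x ((distToSet_eq_zero_iff hG.conn hne).1 hn), pow_zero, mul_one]
  | succ n ih =>
    have hxZ : x ∉ Z := fun h => by
      rw [(distToSet_eq_zero_iff hG.conn hne).2 h] at hn
      omega
    obtain ⟨p, hp, hdp⟩ := exists_adj_distToSet_add_one hG.conn hne hxZ
    rw [hchild n p x (by omega) hp.symm hdp, ih p (by omega)]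
    ring

lemma aF_eq_of_root {Q : ℕ} (hQ : 1 < Q) {l a : ℝ} (hl : 0 < l)
    (ha : ((Q : ℝ) - 1) * a ^ 2 - l * a + 1 = 0) (hal : 2 * ((Q : ℝ) - 1) * a ≤ l) :
    aF Q l = a := by
  have hQ' : (Q : ℝ) - 1 ≠ 0 := by
    have : (1 : ℝ) < Q := by exact_mod_cast hQ
    linarith
  have hsq : 1 - 4 * ((Q : ℝ) - 1) / l ^ 2 = (1 - 2 * ((Q : ℝ) - 1) * a / l) ^ 2 := by
    field_simp
    linear_combination (-4 * ((Q : ℝ) - 1)) * ha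
  have hnn : 0 ≤ 1 - 2 * ((Q : ℝ) - 1) * a / l := by
    rw [sub_nonneg, div_le_one hl]
    exact hal
  rw [aF, hsq, Real.sqrt_sq hnn]
  field_simp
  ring

end CayleyTreeGeodesic

/-- **Theorem 4.3.** For `3 ≤ Q ≤ 7`, with `λ* = ‖A_{𝔾^{Q,2}}‖ = (3−√5)Q/2 + √5` and
`a* = a(λ*)`, the weight `v(x) = (a*)^{d(x,Z)}` is a generalized Perron–Frobenius
eigenvector of `A_{𝔾^{Q,2}} = A + P_{ℓ²(Z)}` (strictly positive, with
`Σ_y (A_{𝔾^{Q,2}})_{xy} v(y) = λ* v(x)` for all `x`), and it is the unique such weight,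
up to a positive multiplicative constant. -/
theorem perron_frobenius_GQ2 (Q : ℕ) (hQ3 : 3 ≤ Q) (hQ7 : Q ≤ 7)
    {V : Type} (G : SimpleGraph V) (hG : IsCayleyTree G Q)
    (A : L2 V →L[ℂ] L2 V) (hA : IsAdjacencyOp G A) (hsa : IsSelfAdjoint A)
    (P : Set V → (L2 V →L[ℂ] L2 V)) (hP : IsProjFamily P)
    (Z : Set V) (hZ : IsRegularSubtree G Z 2)
    (lamstar : ℝ) (hls : lamstar = (3 - Real.sqrt 5) * (Q : ℝ) / 2 + Real.sqrt 5)
    (hnorm : ‖A + P Z‖ = lamstar)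
    (astar : ℝ) (hastar : astar = aF Q lamstar)
    (v : V → ℝ) (hv : ∀ x : V, v x = astar ^ distToSet G x Z) :
    ((∀ x : V, 0 < v x) ∧
      ∀ x : V, (∑' y : G.neighborSet x, v (y : V)) + Z.indicator v x = lamstar * v x)
    ∧ ∀ w : V → ℝ, (∀ x : V, 0 < w x) →
        (∀ x : V, (∑' y : G.neighborSet x, w (y : V)) + Z.indicator w x = lamstar * w x) →
        ∃ c : ℝ, 0 < c ∧ ∀ x : V, w x = c * v x := by
  have hQ3' : (3 : ℝ) ≤ Q := by exact_mod_cast hQ3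
  have hQ7' : (Q : ℝ) ≤ 7 := by exact_mod_cast hQ7
  have h5 : Real.sqrt 5 ^ 2 = 5 := Real.sq_sqrt (by norm_num)
  have h5l : 2.23 < Real.sqrt 5 := Real.lt_sqrt_of_sq_lt (by norm_num)
  have h5u : Real.sqrt 5 < 2.24 := (Real.sqrt_lt' (by norm_num)).2 (by norm_num)
  obtain ⟨a, ha⟩ : ∃ a, a = (3 - Real.sqrt 5) / 2 := ⟨_, rfl⟩
  have ha2 : a ^ 2 = 3 * a - 1 := by
    rw [ha]
    linear_combination h5 / 4
  have hl : lamstar = 3 + ((Q : ℝ) - 2) * a := by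
    rw [hls, ha]
    ring
  have hroot : ((Q : ℝ) - 1) * a ^ 2 - lamstar * a + 1 = 0 := by
    rw [hl]
    linear_combination ha2
  have hapos : 0 < a := by linarith
  have hal : 2 * ((Q : ℝ) - 1) * a ≤ lamstar := by
    rw [hl]
    nlinarith
  have hlpos : 0 < lamstar := by
    rw [hl]
    nlinarith
  have haeq : astar = a := by
    rw [hastar, CayleyTreeGeodesic.aF_eq_of_root (by omega) hlpos hroot hal]
  rw [haeq] at hv
  refine ⟨⟨fun x => ?_, fun x =>
    CayleyTreeGeodesic.pow_distToSet_eigenvector (by omega) hG hZ hroot hl hv x⟩,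
    fun w hw heq => ?_⟩
  · rw [hv]
    positivity
  · obtain ⟨c, hc, h⟩ :=
      CayleyTreeGeodesic.eigenvector_eq_mul_pow (by omega) hG hZ hroot hal hl hw heq
    exact ⟨c, hc, fun x => by rw [h, hv]⟩
end
end
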